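/- Let K be a field of arbitrary characteristic, A a central line arrangement in K² with |A| = n, and m a multiplicity on A. Put exp(A,m) = (d₁,d₂) with d₁ ≤ d₂. If |m| ≥ 2n − 2, then d₁ ≥ n − 1 and d₂ ≥ n − 1. -/

import Mathlib

open MvPolynomial

variable {K : Type*} [Field K]

/-- A subset of `K × K` is a line through the origin. -/
def IsCentralLine (L : Set (K × K)) : Prop :=
  ∃ a b : K, (a, b) ≠ (0, 0) ∧ L = {p : K × K | a * p.1 + b * p.2 = 0}

/-- A central line arrangement: a finite set of lines through the origin of `K²`. -/
def IsCentralArr (A : Finset (Set (K × K))) : Prop :=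
  ∀ L ∈ A, IsCentralLine L

/-- The linear form `a·x + b·y` in `K[x,y]`. -/
noncomputable def lin2 (a b : K) : MvPolynomial (Fin 2) K :=
  C a * X 0 + C b * X 1

/-- The action on `f` of the derivation with coefficient vector `θ`. -/
noncomputable def applyDer2 (θ : Fin 2 → MvPolynomial (Fin 2) K)
    (f : MvPolynomial (Fin 2) K) : MvPolynomial (Fin 2) K :=
  ∑ i, θ i * pderiv i f

/-- `θ` belongs to `D(A,m)`, the logarithmic derivation module of the multiarrangement
`(A, m)`: `θ(α_H) ∈ S'·α_H^{m(H)}` for every `H ∈ A`. -/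
def InDm (A : Finset (Set (K × K))) (m : Set (K × K) → ℕ)
    (θ : Fin 2 → MvPolynomial (Fin 2) K) : Prop :=
  ∀ L ∈ A, ∀ a b : K, (a, b) ≠ (0, 0) →
    L = {p : K × K | a * p.1 + b * p.2 = 0} →
    ∃ g, applyDer2 θ (lin2 a b) = g * lin2 a b ^ m L

/-- A homogeneous derivation of degree `d` on `K[x,y]`. -/
def HomogDer2 (θ : Fin 2 → MvPolynomial (Fin 2) K) (d : ℕ) : Prop :=
  ∀ i, (θ i).IsHomogeneous d

/-- `exp(A,m) = (d₁,d₂)`: the free module `D(A,m)` has a homogeneous basis with degrees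
`d₁` and `d₂`. -/
def IsExpPair (A : Finset (Set (K × K))) (m : Set (K × K) → ℕ) (d₁ d₂ : ℕ) : Prop :=
  ∃ θ₁ θ₂ : Fin 2 → MvPolynomial (Fin 2) K,
    InDm A m θ₁ ∧ InDm A m θ₂ ∧ HomogDer2 θ₁ d₁ ∧ HomogDer2 θ₂ d₂ ∧
    ∀ θ : Fin 2 → MvPolynomial (Fin 2) K, InDm A m θ →
      ∃! cfs : MvPolynomial (Fin 2) K × MvPolynomial (Fin 2) K,
        θ = fun j => cfs.1 * θ₁ j + cfs.2 * θ₂ j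

/-- `|m| = ∑_{H ∈ A} m(H)`. -/
def msize (A : Finset (Set (K × K))) (m : Set (K × K) → ℕ) : ℕ := ∑ H ∈ A, m H

theorem lin2_isHomogeneous (a b : K) : (lin2 a b).IsHomogeneous 1 := by
  simpa [lin2] using ((isHomogeneous_C (Fin 2) a).mul (isHomogeneous_X K 0)).add
    ((isHomogeneous_C (Fin 2) b).mul (isHomogeneous_X K 1))

theorem lin2_ne_zero {a b : K} (h : (a, b) ≠ (0, 0)) : lin2 a b ≠ 0 := by
  intro h0
  have ha := congrArg (eval ![1, 0]) h0
  have hb := congrArg (eval ![0, 1]) h0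
  simp [lin2] at ha hb
  exact h (by simp [ha, hb])

theorem applyDer2_lin2 (θ : Fin 2 → MvPolynomial (Fin 2) K) (a b : K) :
    applyDer2 θ (lin2 a b) = C a * θ 0 + C b * θ 1 := by
  simp [applyDer2, lin2, Fin.sum_univ_two, pderiv_X, Pi.single_apply, mul_comm]

theorem isRelPrime_X_zero_X_one :
    IsRelPrime (X 0 : MvPolynomial (Fin 2) K) (X 1) := by
  refine (X_prime.irreducible.isRelPrime_iff_not_dvd).2 fun h => ?_
  simpa using X_dvd_X.1 h

theorem kernel_eq_of_det_eq_zero {a b c d : K} (hab : (a, b) ≠ (0, 0))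
    (hcd : (c, d) ≠ (0, 0)) (hdet : a * d - b * c = 0) :
    {p : K × K | a * p.1 + b * p.2 = 0} = {p : K × K | c * p.1 + d * p.2 = 0} := by
  have aux : ∀ {a b c d : K}, (a, b) ≠ (0, 0) → a * d - b * c = 0 → ∀ x y : K,
      a * x + b * y = 0 → c * x + d * y = 0 := by
    intro a b c d hab hdet x y hxy
    by_contra hne
    have ha : a * (c * x + d * y) = 0 := by linear_combination c * hxy + y * hdet
    have hb : b * (c * x + d * y) = 0 := by linear_combination d * hxy - x * hdet
    exact hab (Prod.ext ((mul_eq_zero.1 ha).resolve_right hne)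
      ((mul_eq_zero.1 hb).resolve_right hne))
  ext p
  exact ⟨aux hab hdet p.1 p.2, aux hcd (by linear_combination -hdet) p.1 p.2⟩

theorem isRelPrime_lin2 {a b c d : K} (hdet : a * d - b * c ≠ 0) :
    IsRelPrime (lin2 a b) (lin2 c d) := by
  intro p hp hq
  have hu : C (a * d - b * c)⁻¹ * C (a * d - b * c) = (1 : MvPolynomial (Fin 2) K) := by
    rw [← C_mul, inv_mul_cancel₀ hdet, C_1]
  simp only [C_sub, C_mul] at hu
  have h0 : p ∣ X 0 := by
    have := (dvd_sub (hp.mul_left (C d)) (hq.mul_left (C b))).mul_left (C (a * d - b * c)⁻¹)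
    convert this using 1
    simp only [lin2]
    linear_combination -X 0 * hu
  have h1 : p ∣ X 1 := by
    have := (dvd_sub (hq.mul_left (C a)) (hp.mul_left (C c))).mul_left (C (a * d - b * c)⁻¹)
    convert this using 1
    simp only [lin2]
    linear_combination -X 1 * hu
  exact isRelPrime_X_zero_X_one h0 h1

/-- A nonzero polynomial divisible by powers of the defining forms of distinct lines has degree
at least the sum of the exponents. -/
theorem sum_le_totalDegree_of_lin2_pow_dvd {A : Finset (Set (K × K))}
    {a b : Set (K × K) → K} (hab : ∀ L ∈ A, (a L, b L) ≠ (0, 0))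
    (hL : ∀ L ∈ A, L = {p : K × K | a L * p.1 + b L * p.2 = 0})
    (k : Set (K × K) → ℕ) {q : MvPolynomial (Fin 2) K} (hq : q ≠ 0)
    (hdvd : ∀ L ∈ A, lin2 (a L) (b L) ^ k L ∣ q) :
    ∑ L ∈ A, k L ≤ q.totalDegree := by
  have hprod : ∏ L ∈ A, lin2 (a L) (b L) ^ k L ∣ q := by
    refine Finset.prod_dvd_of_isRelPrime (fun L hLA M hMA hne => ?_) hdvd
    refine IsRelPrime.pow (isRelPrime_lin2 fun hdet => hne ?_)
    rw [hL L hLA, hL M hMA]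
    exact kernel_eq_of_det_eq_zero (hab L hLA) (hab M hMA) hdet
  have hhom : (∏ L ∈ A, lin2 (a L) (b L) ^ k L).IsHomogeneous (∑ L ∈ A, k L) :=
    IsHomogeneous.prod _ _ _ fun L _ => by simpa using (lin2_isHomogeneous (a L) (b L)).pow (k L)
  have hne : ∏ L ∈ A, lin2 (a L) (b L) ^ k L ≠ 0 :=
    Finset.prod_ne_zero_iff.2 fun L hLA => pow_ne_zero _ (lin2_ne_zero (hab L hLA))
  rw [← hhom.totalDegree hne]
  exact totalDegree_le_of_dvd_of_isDomain hprod hq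

theorem lin2_dvd_of_dvd_applyDer2 {a b : K} (hab : (a, b) ≠ (0, 0))
    {θ : Fin 2 → MvPolynomial (Fin 2) K} (h : lin2 a b ∣ applyDer2 θ (lin2 a b)) :
    lin2 a b ∣ X 1 * θ 0 - X 0 * θ 1 := by
  obtain ⟨c, hc⟩ := h
  rw [applyDer2_lin2] at hc
  have cancel : ∀ {u : K} {p q : MvPolynomial (Fin 2) K}, u ≠ 0 → p ∣ C u * q → p ∣ q :=
    fun hu => ((hu.isUnit.map C).dvd_mul_left).1
  by_cases ha : a = 0
  · have hb : b ≠ 0 := fun hb => hab (by simp [ha, hb])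
    refine cancel hb ⟨θ 0 - X 0 * c, ?_⟩
    simp only [lin2] at hc ⊢
    linear_combination -X 0 * hc
  · refine cancel ha ⟨X 1 * c - θ 1, ?_⟩
    simp only [lin2] at hc ⊢
    linear_combination X 1 * hc

/-- A derivation annihilating the slope `y/x` is a multiple of the Euler derivation. -/
theorem exists_eq_mul_X_of_eq {θ : Fin 2 → MvPolynomial (Fin 2) K}
    (h : X 1 * θ 0 - X 0 * θ 1 = 0) : ∃ g, ∀ i, θ i = g * X i := by
  obtain ⟨g, hg⟩ : X 0 ∣ θ 0 :=
    isRelPrime_X_zero_X_one.dvd_of_dvd_mul_left ⟨θ 1, by linear_combination h⟩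
  refine ⟨g, Fin.forall_fin_two.2 ⟨by rw [hg, mul_comm], ?_⟩⟩
  apply mul_left_cancel₀ (X_ne_zero (R := K) (0 : Fin 2))
  linear_combination -h + X 1 * hg

/-- A nonzero homogeneous logarithmic derivation of degree `d` satisfies `|A| - 1 ≤ d`, or it is
a multiple of the Euler derivation and `|m| - |A| + 1 ≤ d`. -/
theorem degree_bound_of_inDm {A : Finset (Set (K × K))} (hA : IsCentralArr A)
    {m : Set (K × K) → ℕ} (hm : ∀ H ∈ A, 1 ≤ m H)
    {θ : Fin 2 → MvPolynomial (Fin 2) K} {d : ℕ} (hθ : InDm A m θ) (hhom : HomogDer2 θ d)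
    (hne : θ ≠ 0) : A.card ≤ d + 1 ∨ msize A m + 1 ≤ d + A.card := by
  choose! a b hab hL using hA
  by_cases hE : X 1 * θ 0 - X 0 * θ 1 = 0
  · right
    obtain ⟨g, hg⟩ := exists_eq_mul_X_of_eq hE
    have hg0 : g ≠ 0 := by
      rintro rfl
      exact hne (funext fun i => by simp [hg i])
    have hdeg : g.totalDegree + 1 = d := by
      have h0 : θ 0 ≠ 0 := by
        rw [hg]
        exact mul_ne_zero hg0 (X_ne_zero 0)
      rw [← (hhom 0).totalDegree h0, hg, totalDegree_mul_of_isDomain hg0 (X_ne_zero 0),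
        totalDegree_X]
    have hsum := sum_le_totalDegree_of_lin2_pow_dvd hab hL (fun L => m L - 1) hg0 fun L hLA => by
      obtain ⟨c, hc⟩ := hθ L hLA _ _ (hab L hLA) (hL L hLA)
      refine ⟨c, mul_right_cancel₀ (lin2_ne_zero (hab L hLA)) ?_⟩
      have hpow := pow_sub_one_mul (Nat.one_le_iff_ne_zero.1 (hm L hLA)) (lin2 (a L) (b L))
      rw [applyDer2_lin2, hg, hg, ← hpow] at hc
      calc g * lin2 (a L) (b L) = C (a L) * (g * X 0) + C (b L) * (g * X 1) := by
            simp only [lin2]; ring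
        _ = _ := by rw [hc]; ring
    have hcard : ∑ L ∈ A, (m L - 1) + A.card = msize A m := by
      rw [msize, Finset.card_eq_sum_ones, ← Finset.sum_add_distrib]
      exact Finset.sum_congr rfl fun L hLA => Nat.sub_add_cancel (hm L hLA)
    omega
  · left
    have hsum := sum_le_totalDegree_of_lin2_pow_dvd hab hL (fun _ => 1) hE fun L hLA => by
      obtain ⟨c, hc⟩ := hθ L hLA _ _ (hab L hLA) (hL L hLA)
      rw [pow_one]
      refine lin2_dvd_of_dvd_applyDer2 (hab L hLA) (hc ▸ ?_)
      exact (dvd_pow_self _ (Nat.one_le_iff_ne_zero.1 (hm L hLA))).mul_left c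
    have hEhom : (X 1 * θ 0 - X 0 * θ 1).IsHomogeneous (1 + d) :=
      ((isHomogeneous_X K 1).mul (hhom 0)).sub ((isHomogeneous_X K 0).mul (hhom 1))
    rw [hEhom.totalDegree hE, ← Finset.card_eq_sum_ones] at hsum
    omega

/-- **Lemma 2.8 (1)**. Let `A` be a central line arrangement with `|A| = n` and `m` a
multiplicity with `exp(A,m) = (d₁,d₂)`, `d₁ ≤ d₂`. If `|m| ≥ 2n − 2` then `dᵢ ≥ n − 1`. -/
theorem exponents_ge_of_large_multiplicity
    {K : Type*} [Field K] (A : Finset (Set (K × K))) (hA : IsCentralArr A)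
    (n : ℕ) (hn : A.card = n)
    (m : Set (K × K) → ℕ) (hm : ∀ H ∈ A, 1 ≤ m H)
    (d₁ d₂ : ℕ) (hd : d₁ ≤ d₂) (hexp : IsExpPair A m d₁ d₂)
    (hsize : 2 * (n : ℤ) - 2 ≤ (msize A m : ℤ)) :
    (n : ℤ) - 1 ≤ (d₁ : ℤ) ∧ (n : ℤ) - 1 ≤ (d₂ : ℤ) := by
  obtain ⟨θ₁, θ₂, h₁, -, hom₁, -, hbasis⟩ := hexp
  have hne : θ₁ ≠ 0 := by
    rintro rfl
    have huniq := (hbasis 0 fun L _ a b _ _ => ⟨0, by simp [applyDer2]⟩).unique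
      (y₁ := (0, 0)) (y₂ := (1, 0)) (by ext; simp) (by ext; simp)
    simp at huniq
  have := degree_bound_of_inDm hA hm h₁ hom₁ hne
  omega
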